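/- Let P ⊂ ℝ^n be a full-dimensional smooth lattice polytope that is canonically positioned, such that every edge of P has lattice length exactly 1 and e_i + e_j ∈ P for all i, j ∈ {1, …, n} with i ≠ j. If there exists i ∈ {1, …, n} such that 2e_i + e_j ∉ P for every j ∈ {1, …, n}, then P ⊆ {x : 0 ≤ x_i ≤ 1}; in particular, P is a Cayley polytope of order 1 with altitude in direction e_i. -/

import Mathlib

open Set

/-- The real point corresponding to an integer lattice point. -/
def toR {n : ℕ} (v : Fin n → ℤ) : Fin n → ℝ := fun i => (v i : ℝ)

/-- `P` is a lattice polytope: the convex hull of a finite set of integer points. -/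
def IsLatticePolytope {n : ℕ} (P : Set (Fin n → ℝ)) : Prop :=
  ∃ S : Finset (Fin n → ℤ), P = convexHull ℝ (toR '' (S : Set (Fin n → ℤ)))

/-- `P` is full-dimensional: its affine span is everything. -/
def IsFullDim {n : ℕ} (P : Set (Fin n → ℝ)) : Prop :=
  affineSpan ℝ P = ⊤

/-- A vertex of `P` is an extreme point of `P`. -/
def IsVertex {n : ℕ} (P : Set (Fin n → ℝ)) (v : Fin n → ℝ) : Prop :=
  v ∈ Set.extremePoints ℝ P

/-- The segment from `a` to `b` (distinct integer points) is an edge of `P`,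
i.e. an exposed face of `P` which is a segment. -/
def IsEdge {n : ℕ} (P : Set (Fin n → ℝ)) (a b : Fin n → ℤ) : Prop :=
  a ≠ b ∧ IsExposed ℝ P (segment ℝ (toR a) (toR b))

/-- The lattice length of an integer vector: the gcd of its entries. -/
def latticeLength {n : ℕ} (v : Fin n → ℤ) : ℕ :=
  Finset.univ.gcd fun i => (v i).natAbs

/-- The primitive integer vector in the direction of `v`. -/
def primVec {n : ℕ} (v : Fin n → ℤ) : Fin n → ℤ :=
  fun i => v i / (latticeLength v : ℤ)

/-- `P` is smooth at the integer vertex `v`: there are exactly `n` edges through `v`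
and the primitive directions of these edges form a `ℤ`-basis of `ℤⁿ`. -/
def SmoothAtVertex {n : ℕ} (P : Set (Fin n → ℝ)) (v : Fin n → ℤ) : Prop :=
  ∃ b : Fin n → (Fin n → ℤ),
    Function.Injective b ∧
    (∀ i, IsEdge P v (b i)) ∧
    (∀ c : Fin n → ℤ, IsEdge P v c →
      ∃ i, segment ℝ (toR v) (toR c) = segment ℝ (toR v) (toR (b i))) ∧
    IsUnit (Matrix.det (Matrix.of fun i => primVec (b i - v)))

/-- `P` is a full-dimensional smooth lattice polytope. -/
def IsSmoothPolytope {n : ℕ} (P : Set (Fin n → ℝ)) : Prop :=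
  IsLatticePolytope P ∧ IsFullDim P ∧
    ∀ v : Fin n → ℤ, IsVertex P (toR v) → SmoothAtVertex P v

/-- Every edge of `P` has lattice length at least `k`. -/
def EdgesAtLeast {n : ℕ} (P : Set (Fin n → ℝ)) (k : ℕ) : Prop :=
  ∀ a b : Fin n → ℤ, IsEdge P a b → k ≤ latticeLength (b - a)

/-- `P` is a Cayley polytope of order `k` with altitude in direction `eᵢ`:
`P ⊆ {x : 0 ≤ xᵢ ≤ k}` and every vertex of `P` has `i`-th coordinate `0` or `k`. -/
def IsCayley {n : ℕ} (P : Set (Fin n → ℝ)) (k : ℕ) (i : Fin n) : Prop :=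
  (∀ x ∈ P, 0 ≤ x i ∧ x i ≤ (k : ℝ)) ∧
  (∀ v : Fin n → ℝ, IsVertex P v → v i = 0 ∨ v i = (k : ℝ))

/-- `P` is canonically positioned: `0` is a vertex and for each `i` there is an
edge of `P` contained in the nonnegative `xᵢ`-coordinate axis. -/
def CanonicallyPositioned {n : ℕ} (P : Set (Fin n → ℝ)) : Prop :=
  IsVertex P 0 ∧
  ∀ i : Fin n, ∃ a b : Fin n → ℤ, IsEdge P a b ∧
    segment ℝ (toR a) (toR b) ⊆ {x | 0 ≤ x i ∧ ∀ j, j ≠ i → x j = 0}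

/-- `F` is a facet of `P`: an exposed face of dimension `n - 1`. -/
def IsFacet {n : ℕ} (P F : Set (Fin n → ℝ)) : Prop :=
  IsExposed ℝ P F ∧ Module.finrank ℝ (affineSpan ℝ F).direction = n - 1

/-- The lattice width of `Q`: the minimum over nonzero integer functionals `φ` of
`max_{x ∈ Q} ⟨φ, x⟩ - min_{x ∈ Q} ⟨φ, x⟩`. -/
noncomputable def latticeWidth {n : ℕ} (Q : Set (Fin n → ℝ)) : ℝ :=
  ⨅ φ : {φ : Fin n → ℤ // φ ≠ 0},
    (sSup ((fun x => ∑ i, (φ.1 i : ℝ) * x i) '' Q) -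
      sInf ((fun x => ∑ i, (φ.1 i : ℝ) * x i) '' Q))

open scoped NNReal in
/-- A finite family of vectors in an open half-space is contained in the cone generated by those
of its members that span exposed rays. -/
lemma exists_exposed_generators {E : Type*} [NormedAddCommGroup E] [NormedSpace ℝ E]
    (D : Finset E) (f : E →L[ℝ] ℝ) (hf : ∀ d ∈ D, 0 < f d) :
    ∃ T ⊆ D, (∀ d ∈ D, d ∈ Submodule.span ℝ≥0 (T : Set E)) ∧
      ∀ t ∈ T, ∃ g : E →L[ℝ] ℝ, g t = 0 ∧
        ∀ d ∈ D, g d ≤ 0 ∧ (g d = 0 → ∃ μ : ℝ, 0 ≤ μ ∧ d = μ • t) := by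
  classical
  obtain ⟨T, hT, hmin⟩ := Finset.exists_min_image
    (D.powerset.filter fun T : Finset E => ∀ d ∈ D, d ∈ Submodule.span ℝ≥0 (T : Set E)) Finset.card
    ⟨D, by simpa using fun d hd => Submodule.subset_span (Finset.mem_coe.2 hd)⟩
  simp only [Finset.mem_filter, Finset.mem_powerset] at hT hmin
  obtain ⟨hTD, hspan⟩ := hT
  refine ⟨T, hTD, hspan, fun t ht => ?_⟩
  have hnot : t ∉ Submodule.span ℝ≥0 ((T.erase t : Finset E) : Set E) := by
    intro h
    have hle : Submodule.span ℝ≥0 (T : Set E) ≤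
        Submodule.span ℝ≥0 ((T.erase t : Finset E) : Set E) := by
      refine Submodule.span_le.2 fun s hs => ?_
      by_cases hst : s = t
      · exact hst ▸ h
      · exact Submodule.subset_span (Finset.mem_coe.2 (Finset.mem_erase.2 ⟨hst, hs⟩))
    have := hmin (T.erase t) ⟨(Finset.erase_subset _ _).trans hTD, fun d hd => hle (hspan d hd)⟩
    have := Finset.card_erase_lt_of_mem ht
    omega
  have hdisj : Disjoint (convexHull ℝ ((T.erase t : Finset E) : Set E))
      (Submodule.span ℝ {t} : Set E) := by
    rw [Set.disjoint_left]
    intro y hy hyt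
    obtain ⟨μ, rfl⟩ := Submodule.mem_span_singleton.1 hyt
    have hpos : 0 < f (μ • t) := by
      have : convexHull ℝ ((T.erase t : Finset E) : Set E) ⊆ {x | 0 < f x} :=
        convexHull_min (fun s hs => hf s (hTD (Finset.mem_of_mem_erase hs)))
          (convex_halfSpace_gt f.isLinear 0)
      exact this hy
    have hμ : 0 < μ := by
      rw [map_smul, smul_eq_mul] at hpos
      exact (pos_iff_pos_of_mul_pos hpos).2 (hf t (hTD ht))
    have hmem : μ • t ∈ Submodule.span ℝ≥0 ((T.erase t : Finset E) : Set E) := by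
      refine convexHull_min (t := (Submodule.span ℝ≥0 ((T.erase t : Finset E) : Set E) : Set E))
        Submodule.subset_span ?_ hy
      intro x hx y hy a b ha hb _
      exact add_mem (Submodule.smul_mem _ (⟨a, ha⟩ : ℝ≥0) hx)
        (Submodule.smul_mem _ (⟨b, hb⟩ : ℝ≥0) hy)
    refine hnot ?_
    have : μ⁻¹ • μ • t ∈ _ := Submodule.smul_mem _ (⟨μ⁻¹, by positivity⟩ : ℝ≥0) hmem
    rwa [smul_smul, inv_mul_cancel₀ hμ.ne', one_smul] at this
  obtain ⟨g, u, w, hgu, huw, hgw⟩ := geometric_hahn_banach_compact_closed (convex_convexHull ℝ _)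
    ((T.erase t).finite_toSet.isCompact_convexHull ℝ)
    (Submodule.span ℝ {t}).convex (Submodule.span ℝ {t}).closed_of_finiteDimensional hdisj
  have hw : w < 0 := by simpa using hgw 0 (zero_mem _)
  have hgt : g t = 0 := by
    by_contra h
    have := hgw ((w / g t) • t) (Submodule.smul_mem _ _ (Submodule.mem_span_singleton_self t))
    rw [map_smul, smul_eq_mul, div_mul_cancel₀ _ h] at this
    exact lt_irrefl _ this
  refine ⟨g, hgt, fun d hd => ?_⟩
  replace hd := hspan d hd
  induction hd using Submodule.span_induction with
  | mem s hs =>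
    by_cases hst : s = t
    · exact ⟨by rw [hst, hgt], fun _ => ⟨1, zero_le_one, by rw [hst, one_smul]⟩⟩
    · have := hgu s (subset_convexHull ℝ _ (Finset.mem_coe.2 (Finset.mem_erase.2 ⟨hst, hs⟩)))
      exact ⟨by linarith, fun h => by linarith⟩
  | zero => exact ⟨by simp, fun _ => ⟨0, le_rfl, by simp⟩⟩
  | add x y _ _ hx hy =>
    rw [map_add]
    refine ⟨by linarith [hx.1, hy.1], fun h => ?_⟩
    obtain ⟨μ, hμ, h1⟩ := hx.2 (by linarith [hx.1, hy.1])
    obtain ⟨ν, hν, h2⟩ := hy.2 (by linarith [hx.1, hy.1])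
    exact ⟨μ + ν, by positivity, by rw [add_smul, ← h1, ← h2]⟩
  | smul a x _ hx =>
    rw [NNReal.smul_def, map_smul, smul_eq_mul]
    refine ⟨mul_nonpos_of_nonneg_of_nonpos a.2 hx.1, fun h => ?_⟩
    rcases mul_eq_zero.1 h with h | h
    · exact ⟨0, le_rfl, by simp [h]⟩
    · obtain ⟨μ, hμ, h1⟩ := hx.2 h
      exact ⟨a * μ, by positivity, by rw [mul_smul, ← h1]⟩

lemma toR_injective {n : ℕ} : Function.Injective (toR (n := n)) := fun a b h => by
  funext i
  exact Int.cast_injective (congrFun h i)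

lemma toR_sub {n : ℕ} (a b : Fin n → ℤ) : toR (a - b) = toR a - toR b := by
  funext i
  simp [toR]

lemma mem_segment_iff_exists_smul_sub {n : ℕ} {a b x : Fin n → ℝ} :
    x ∈ segment ℝ a b ↔ ∃ θ : ℝ, 0 ≤ θ ∧ θ ≤ 1 ∧ x - a = θ • (b - a) := by
  rw [segment_eq_image']
  constructor
  · rintro ⟨θ, hθ, rfl⟩
    exact ⟨θ, hθ.1, hθ.2, by simp⟩
  · rintro ⟨θ, h0, h1, h⟩
    exact ⟨θ, ⟨h0, h1⟩, by simp [← h]⟩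

lemma eq_of_segment_eq {n : ℕ} {a b c : Fin n → ℝ} (h : segment ℝ a b = segment ℝ a c) :
    b = c := by
  obtain ⟨θ, h0, h1, hb⟩ := mem_segment_iff_exists_smul_sub.1 (h ▸ right_mem_segment ℝ a b)
  obtain ⟨η, k0, k1, hc⟩ := mem_segment_iff_exists_smul_sub.1 (h ▸ right_mem_segment ℝ a c)
  have hm : (1 - θ * η) • (b - a) = 0 := by
    rw [sub_smul, one_smul, mul_smul, ← hc, ← hb, sub_self]
  rcases smul_eq_zero.1 hm with hm | hm
  · have : θ = 1 := by nlinarith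
    rw [this, one_smul] at hb
    exact sub_left_injective hb
  · rw [hm, smul_zero] at hc
    rw [sub_eq_zero.1 hm, sub_eq_zero.1 hc]

lemma IsEdge.symm {n : ℕ} {P : Set (Fin n → ℝ)} {a b : Fin n → ℤ} (h : IsEdge P a b) :
    IsEdge P b a :=
  ⟨h.1.symm, segment_symm ℝ (toR a) (toR b) ▸ h.2⟩

lemma IsEdge.left_mem {n : ℕ} {P : Set (Fin n → ℝ)} {a b : Fin n → ℤ} (h : IsEdge P a b) :
    toR a ∈ P :=
  h.2.subset (left_mem_segment ℝ _ _)

lemma IsEdge.isVertex_left {n : ℕ} {P : Set (Fin n → ℝ)} {a b : Fin n → ℤ} (h : IsEdge P a b) :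
    IsVertex P (toR a) := by
  refine h.2.isExtreme.extremePoints_subset_extremePoints ⟨left_mem_segment ℝ _ _, ?_⟩
  rintro x hx y hy ⟨p, q, hp, hq, hpq, hxy⟩
  obtain ⟨s, hs, -, hxs⟩ := mem_segment_iff_exists_smul_sub.1 hx
  obtain ⟨t, ht, -, hyt⟩ := mem_segment_iff_exists_smul_sub.1 hy
  have hab : toR b - toR a ≠ 0 := sub_ne_zero.2 fun e => h.1 (toR_injective e).symm
  have hz : (p * s + q * t) • (toR b - toR a) = 0 := by
    rw [add_smul, mul_smul, mul_smul, ← hxs, ← hyt, smul_sub, smul_sub]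
    calc p • x - p • toR a + (q • y - q • toR a)
        = (p • x + q • y) - (p + q) • toR a := by rw [add_smul]; abel
      _ = 0 := by rw [hxy, hpq, one_smul, sub_self]
  have hs0 : s = 0 := by
    have := (smul_eq_zero.1 hz).resolve_right hab
    nlinarith [mul_nonneg hp.le hs, mul_nonneg hq.le ht, mul_pos hp hq]
  rw [hs0, zero_smul] at hxs
  exact sub_eq_zero.1 hxs

open scoped NNReal in
/-- A lattice polytope is contained in the cone spanned at a vertex by the edges through it. -/
lemma sub_mem_span_edges {n : ℕ} {P : Set (Fin n → ℝ)} (hP : IsLatticePolytope P)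
    {v : Fin n → ℤ} (hv : IsVertex P (toR v)) {ι : Type*} (b : ι → Fin n → ℤ)
    (hb : ∀ c, IsEdge P v c → ∃ k, b k = c) {x : Fin n → ℝ} (hx : x ∈ P) :
    x - toR v ∈ Submodule.span ℝ≥0 (Set.range fun k => toR (b k - v)) := by
  classical
  obtain ⟨S, hS⟩ := hP
  have hconv : Convex ℝ P := hS ▸ convex_convexHull ℝ _
  have hSP : ∀ s ∈ S, toR s ∈ P := fun s hs => hS ▸ subset_convexHull ℝ _ ⟨s, hs, rfl⟩
  have hvnot : toR v ∉ convexHull ℝ (toR '' ((S.erase v : Finset _) : Set (Fin n → ℤ))) := by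
    intro h
    have hc := ((hconv.mem_extremePoints_iff_convex_sdiff).1 hv).2
    refine (convexHull_min (t := P \ {toR v}) ?_ hc h).2 rfl
    rintro _ ⟨s, hs, rfl⟩
    have hs' := Finset.mem_erase.1 hs
    exact ⟨hSP s hs'.2, fun e => hs'.1 (toR_injective e)⟩
  obtain ⟨f, u, hfv, hfu⟩ := geometric_hahn_banach_point_closed (convex_convexHull ℝ _)
    (((S.erase v).finite_toSet.image toR).isClosed_convexHull ℝ) hvnot
  set D := (S.erase v).image fun s => toR s - toR v
  have hfS : ∀ s ∈ S, s ≠ v → f (toR v) < f (toR s) := fun s hs hsv =>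
    hfv.trans (hfu _ (subset_convexHull ℝ _ ⟨s, Finset.mem_erase.2 ⟨hsv, hs⟩, rfl⟩))
  obtain ⟨T, hTD, hspan, hexp⟩ := exists_exposed_generators D f (by
    intro d hd
    obtain ⟨s, hs, rfl⟩ := Finset.mem_image.1 hd
    have hs' := Finset.mem_erase.1 hs
    simpa using hfS s hs'.2 hs'.1)
  have hT : ∀ t ∈ T, t ∈ Submodule.span ℝ≥0 (Set.range fun k => toR (b k - v)) := by
    intro t ht
    obtain ⟨g, hgt, hg⟩ := hexp t ht
    obtain ⟨s₀, hs₀, rfl⟩ := Finset.mem_image.1 (hTD ht)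
    have hs₀' := Finset.mem_erase.1 hs₀
    have hgS : ∀ s ∈ S, g (toR s - toR v) ≤ 0 ∧ (g (toR s - toR v) = 0 →
        ∃ μ : ℝ, 0 ≤ μ ∧ toR s - toR v = μ • (toR s₀ - toR v)) := by
      intro s hs
      by_cases hsv : s = v
      · exact ⟨by simp [hsv], fun _ => ⟨0, le_rfl, by simp [hsv]⟩⟩
      · exact hg _ (Finset.mem_image_of_mem _ (Finset.mem_erase.2 ⟨hsv, hs⟩))
    have hft : 0 < f (toR s₀ - toR v) := by
      simpa using hfS s₀ hs₀'.2 hs₀'.1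
    obtain ⟨c, hc, hcmax⟩ := Finset.exists_max_image
      (S.filter fun s => g (toR s - toR v) = 0) (fun s => f (toR s - toR v))
      ⟨s₀, Finset.mem_filter.2 ⟨hs₀'.2, hgt⟩⟩
    obtain ⟨hcS, hgc⟩ := Finset.mem_filter.1 hc
    obtain ⟨μ, hμ, hcμ⟩ := (hgS c hcS).2 hgc
    have hfc : f (toR s₀ - toR v) ≤ f (toR c - toR v) :=
      hcmax s₀ (Finset.mem_filter.2 ⟨hs₀'.2, hgt⟩)
    have hμpos : 0 < μ := by
      rw [hcμ, map_smul, smul_eq_mul] at hfc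
      nlinarith
    have hface : ∀ x ∈ P, g x ≤ g (toR v) ∧
        (g x = g (toR v) → x ∈ segment ℝ (toR v) (toR c)) := by
      have hsub : P ⊆ {x | g x ≤ g (toR v) ∧
          (g x = g (toR v) → x ∈ segment ℝ (toR v) (toR c))} := by
        rw [hS]
        refine convexHull_min ?_ ?_
        · rintro _ ⟨s, hs, rfl⟩
          have h := hgS s hs
          rw [map_sub, sub_nonpos, sub_eq_zero] at h
          refine ⟨h.1, fun hgs => ?_⟩
          obtain ⟨ν, hν, hsν⟩ := h.2 hgs
          have hle := hcmax s (Finset.mem_filter.2 ⟨hs, by rw [map_sub, hgs, sub_self]⟩)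
          rw [hsν, hcμ, map_smul, map_smul, smul_eq_mul, smul_eq_mul] at hle
          refine mem_segment_iff_exists_smul_sub.2
            ⟨ν / μ, by positivity, (div_le_one hμpos).2 (le_of_mul_le_mul_right hle hft), ?_⟩
          rw [hcμ, smul_smul, div_mul_cancel₀ _ hμpos.ne', hsν]
        · rintro y hy z hz p q hp hq hpq
          have e : g (p • y + q • z) = p * g y + q * g z := by simp
          have e' : g (toR v) = p * g (toR v) + q * g (toR v) := by
            rw [← add_mul, hpq, one_mul]
          have hpy := mul_le_mul_of_nonneg_left hy.1 hp
          have hqz := mul_le_mul_of_nonneg_left hz.1 hq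
          refine ⟨by linarith, fun h => ?_⟩
          rcases hp.eq_or_lt with rfl | hp'
          · obtain rfl : q = 1 := by linarith
            have hz' := hz.2 (by linarith)
            simpa using hz'
          rcases hq.eq_or_lt with rfl | hq'
          · obtain rfl : p = 1 := by linarith
            have hy' := hy.2 (by linarith)
            simpa using hy'
          refine convex_segment _ _ (hy.2 ?_) (hz.2 ?_) hp hq hpq
          · exact mul_left_cancel₀ hp'.ne' (by linarith)
          · exact mul_left_cancel₀ hq'.ne' (by linarith)
      exact fun x hx => hsub hx
    have hvP : toR v ∈ P := hv.1
    have hgcv : g (toR c) = g (toR v) := by simpa [sub_eq_zero] using hgc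
    have hvc : IsEdge P v c := by
      refine ⟨fun e => ?_, fun _ => ⟨g, ?_⟩⟩
      · rw [← e, sub_self, map_zero] at hfc
        linarith
      · refine Set.Subset.antisymm (fun x hx => ?_) fun x hx => (hface x hx.1).2 ?_
        · have hxP := hconv.segment_subset hvP (hSP c hcS) hx
          refine ⟨hxP, fun y hy => (hface y hy).1.trans_eq ?_⟩
          obtain ⟨p, q, -, -, hpq, rfl⟩ := hx
          rw [map_add, map_smul, map_smul, hgcv, ← add_smul, hpq, one_smul]
        · exact le_antisymm (hface x hx.1).1 (hx.2 _ hvP)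
    obtain ⟨k, rfl⟩ := hb c hvc
    have hmem : toR (b k - v) ∈ Submodule.span ℝ≥0 (Set.range fun k => toR (b k - v)) :=
      Submodule.subset_span ⟨k, rfl⟩
    have : μ⁻¹ • toR (b k - v) ∈ _ := Submodule.smul_mem _ (⟨μ⁻¹, by positivity⟩ : ℝ≥0) hmem
    rwa [toR_sub, hcμ, smul_smul, inv_mul_cancel₀ hμpos.ne',
      one_smul] at this
  have hDspan : ∀ d ∈ D, d ∈ Submodule.span ℝ≥0 (Set.range fun k => toR (b k - v)) :=
    fun d hd => Submodule.span_le.2 hT (hspan d hd)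
  have hsub : P ⊆ {y | y - toR v ∈ Submodule.span ℝ≥0 (Set.range fun k => toR (b k - v))} := by
    rw [hS]
    refine convexHull_min ?_ ?_
    · rintro _ ⟨s, hs, rfl⟩
      by_cases hsv : s = v
      · simp [hsv]
      · exact hDspan _ (Finset.mem_image_of_mem _ (Finset.mem_erase.2 ⟨hsv, hs⟩))
    · intro y hy z hz p q hp hq hpq
      have e : p • y + q • z - toR v = p • (y - toR v) + q • (z - toR v) := by
        calc _ = p • y + q • z - (p + q) • toR v := by rw [hpq, one_smul]
          _ = _ := by rw [add_smul, smul_sub, smul_sub]; abel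
      rw [Set.mem_ofPred_eq, e]
      exact add_mem (Submodule.smul_mem _ (⟨p, hp⟩ : ℝ≥0) hy)
        (Submodule.smul_mem _ (⟨q, hq⟩ : ℝ≥0) hz)
  exact hsub hx

lemma exists_nonneg_coeff_of_mem_span {n : ℕ} {ι : Type*} [Fintype ι] {u : ι → Fin n → ℤ} {x : Fin n → ℝ}
    (hx : x ∈ Submodule.span NNReal (Set.range fun k => toR (u k))) :
    ∃ c : ι → ℝ, (∀ k, 0 ≤ c k) ∧ ∀ m, x m = ∑ k, c k * (u k m : ℝ) := by
  obtain ⟨c, rfl⟩ := (Submodule.mem_span_range_iff_exists_fun _).1 hx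
  exact ⟨fun k => c k, fun k => (c k).2, fun m => by
    simp [Finset.sum_apply, toR, NNReal.smul_def]⟩

lemma primVec_eq_self {n : ℕ} {v : Fin n → ℤ} (h : latticeLength v = 1) : primVec v = v := by
  funext i
  simp [primVec, h]

lemma eq_one_of_latticeLength_single {n : ℕ} {j : Fin n} {β : ℤ} (hβ : 0 ≤ β)
    (h : latticeLength (Pi.single j β) = 1) : β = 1 := by
  have hdvd : β.natAbs ∣ latticeLength (Pi.single j β) := by
    refine Finset.dvd_gcd fun m _ => ?_
    by_cases hm : m = j
    · simp [hm]
    · simp [Pi.single_eq_of_ne hm]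
  rw [h, Nat.dvd_one] at hdvd
  omega

/-- In a canonically positioned polytope with unit edges, the edges at the origin are the standard
basis vectors. -/
lemma CanonicallyPositioned.isEdge_single {n : ℕ} {P : Set (Fin n → ℝ)}
    (hpos : CanonicallyPositioned P)
    (hEdge : ∀ a b : Fin n → ℤ, IsEdge P a b → latticeLength (b - a) = 1) (j : Fin n) :
    IsEdge P 0 (Pi.single j 1) := by
  obtain ⟨a, b, hab, haxis⟩ := hpos.2 j
  have hsingle : ∀ c : Fin n → ℤ, toR c ∈ segment ℝ (toR a) (toR b) →
      0 ≤ c j ∧ c = Pi.single j (c j) := by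
    intro c hc
    obtain ⟨h0, h1⟩ := haxis hc
    refine ⟨by simpa [toR] using h0, ?_⟩
    funext m
    by_cases hm : m = j
    · simp [hm]
    · simpa [toR, Pi.single_eq_of_ne hm] using h1 m hm
  have key : ∀ c, IsEdge P 0 c → 0 ≤ c j ∧ c = Pi.single j (c j) →
      IsEdge P 0 (Pi.single j 1) := by
    rintro c hc ⟨h0, h1⟩
    have hl := hEdge _ _ hc
    rw [sub_zero, h1] at hl
    rw [h1, eq_one_of_latticeLength_single h0 hl] at hc
    exact hc
  obtain ⟨ha0, ha⟩ := hsingle a (left_mem_segment ℝ _ _)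
  obtain ⟨hb0, hb⟩ := hsingle b (right_mem_segment ℝ _ _)
  have htoR : ∀ β : ℤ, toR (Pi.single j β) = (β : ℝ) • (Pi.single j 1 : Fin n → ℝ) := by
    intro β
    funext m
    by_cases hm : m = j
    · subst hm; simp [toR]
    · simp [toR, Pi.single_eq_of_ne hm]
  have hne : (a j : ℝ) - b j ≠ 0 := by
    rw [sub_ne_zero]
    intro e
    exact hab.1 (by rw [ha, hb, Int.cast_injective e])
  obtain ⟨l, hl⟩ := hab.2 ⟨_, left_mem_segment ℝ _ _⟩
  have hla : toR a ∈ {x ∈ P | ∀ y ∈ P, l y ≤ l x} := hl ▸ left_mem_segment ℝ _ _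
  have hlb : toR b ∈ {x ∈ P | ∀ y ∈ P, l y ≤ l x} := hl ▸ right_mem_segment ℝ _ _
  have hlz : l (toR a) = 0 := by
    have e := le_antisymm (hlb.2 _ hla.1) (hla.2 _ hlb.1)
    rw [ha, hb, htoR, htoR, map_smul, map_smul, smul_eq_mul, smul_eq_mul] at e
    have : l (Pi.single j 1 : Fin n → ℝ) = 0 :=
      (mul_eq_zero.1 (show ((a j : ℝ) - b j) * _ = 0 by linarith)).resolve_left hne
    rw [ha, htoR, map_smul, this, smul_zero]
  have hzero : (0 : Fin n → ℝ) ∈ segment ℝ (toR a) (toR b) := by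
    rw [hl]
    exact ⟨hpos.1.1, fun y hy => by rw [map_zero, ← hlz]; exact hla.2 y hy⟩
  obtain ⟨p, q, hp, hq, hpq, h0⟩ := hzero
  have h0j : p * (a j : ℝ) + q * b j = 0 := by simpa [toR] using congrFun h0 j
  have haR : (0 : ℝ) ≤ a j := by exact_mod_cast ha0
  have hbR : (0 : ℝ) ≤ b j := by exact_mod_cast hb0
  have h1 := mul_nonneg hp haR
  have h2 := mul_nonneg hq hbR
  rcases hp.eq_or_lt with rfl | hp
  · have : (b j : ℝ) = 0 := by
      have : q = 1 := by linarith
      rw [this] at h0j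
      linarith
    have hbz : b = 0 := by rw [hb, Int.cast_eq_zero.1 this, Pi.single_zero]
    exact key a (hbz ▸ hab.symm) ⟨ha0, ha⟩
  · have : (a j : ℝ) = 0 :=
      (mul_eq_zero.1 (show p * (a j : ℝ) = 0 by linarith)).resolve_left hp.ne'
    have haz : a = 0 := by rw [ha, Int.cast_eq_zero.1 this, Pi.single_zero]
    exact key b (haz ▸ hab) ⟨hb0, hb⟩

/-- The edges at a smooth vertex of a lattice polytope with unit edges form a lattice basis
generating a cone that contains the polytope. -/
lemma SmoothAtVertex.exists_basis {n : ℕ} {P : Set (Fin n → ℝ)} (hP : IsLatticePolytope P)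
    (hEdge : ∀ a b : Fin n → ℤ, IsEdge P a b → latticeLength (b - a) = 1)
    {v : Fin n → ℤ} (hv : IsVertex P (toR v)) (hs : SmoothAtVertex P v) :
    ∃ u : Fin n → Fin n → ℤ,
      (∀ k, IsEdge P v (v + u k)) ∧ (∀ c, IsEdge P v c → ∃ k, u k = c - v) ∧
      IsUnit (Matrix.of u).det ∧
      ∀ x ∈ P, ∃ c : Fin n → ℝ, (∀ k, 0 ≤ c k) ∧
        ∀ m, x m = v m + ∑ k, c k * (u k m : ℝ) := by
  obtain ⟨b, -, hbe, hbc, hdet⟩ := hs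
  have hbc' : ∀ c, IsEdge P v c → ∃ k, b k = c := fun c hc => by
    obtain ⟨k, hk⟩ := hbc c hc
    exact ⟨k, (toR_injective (eq_of_segment_eq hk)).symm⟩
  refine ⟨fun k => b k - v, fun k => by simpa using hbe k, fun c hc => ?_, ?_, fun x hx => ?_⟩
  · obtain ⟨k, rfl⟩ := hbc' c hc
    exact ⟨k, rfl⟩
  · simpa only [primVec_eq_self (hEdge _ _ (hbe _))] using hdet
  · obtain ⟨c, hc, hxc⟩ := exists_nonneg_coeff_of_mem_span (sub_mem_span_edges hP hv b hbc' hx)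
    exact ⟨c, hc, fun m => by rw [← hxc m]; simp [toR]⟩

lemma nonneg_of_mem {n : ℕ} {P : Set (Fin n → ℝ)} (hP : IsSmoothPolytope P)
    (hpos : CanonicallyPositioned P)
    (hEdge : ∀ a b : Fin n → ℤ, IsEdge P a b → latticeLength (b - a) = 1)
    {x : Fin n → ℝ} (hx : x ∈ P) (m : Fin n) : 0 ≤ x m := by
  have h0 : IsVertex P (toR 0) := (hpos.isEdge_single hEdge m).isVertex_left
  obtain ⟨u, -, hu, -, hcone⟩ := (hP.2.2 0 h0).exists_basis hP.1 hEdge h0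
  choose κ hκ using fun j => hu _ (hpos.isEdge_single hEdge j)
  simp only [sub_zero] at hκ
  have hinj : Function.Injective κ := fun j j' h => by
    have := congrFun ((hκ j).symm.trans (h ▸ hκ j')) j
    by_contra hne
    simp [Pi.single_eq_of_ne hne] at this
  obtain ⟨c, hc, hxc⟩ := hcone x hx
  rw [hxc m]
  simp only [Pi.zero_apply, Int.cast_zero, zero_add]
  refine Finset.sum_nonneg fun k _ => mul_nonneg (hc k) ?_
  obtain ⟨j, rfl⟩ := Finite.surjective_of_injective hinj k
  rw [hκ j]
  by_cases hm : m = j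
  · simp [hm]
  · simp [Pi.single_eq_of_ne hm]

/-- In a unimodular matrix with `-eᵢ` as a row, a row supported on `{i, j}` has its `j`-entry a unit
whenever that entry is nonzero. -/
lemma isUnit_of_row_support {n : ℕ} {u : Fin n → Fin n → ℤ} (hdet : IsUnit (Matrix.of u).det)
    {i j k k₀ : Fin n} (hij : j ≠ i) (hk₀ : u k₀ = -Pi.single i 1)
    (hkj : u k j ≠ 0) (hk : ∀ m, m ≠ i → m ≠ j → u k m = 0) : IsUnit (u k j) := by
  have hentry : ∀ r, ∑ m, u r m * (Matrix.of u)⁻¹ m k = (1 : Matrix (Fin n) (Fin n) ℤ) r k :=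
    fun r => by rw [← Matrix.mul_nonsing_inv _ hdet, Matrix.mul_apply]; rfl
  have hne : k₀ ≠ k := by
    rintro rfl
    simp [hk₀, Pi.single_eq_of_ne hij] at hkj
  have h₀ : (Matrix.of u)⁻¹ i k = 0 := by
    have := hentry k₀
    rw [Matrix.one_apply_ne hne, Finset.sum_eq_single i] at this
    · simpa [hk₀] using this
    · intro m _ hm
      simp [hk₀, Pi.single_eq_of_ne hm]
    · simp
  have h₁ := hentry k
  rw [Matrix.one_apply_eq, Finset.sum_eq_single j] at h₁
  · exact IsUnit.of_mul_eq_one _ h₁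
  · intro m _ hm
    by_cases hmi : m = i
    · rw [hmi, h₀, mul_zero]
    · rw [hk m hmi hm, zero_mul]
  · simp

lemma coord_le_one {n : ℕ} {P : Set (Fin n → ℝ)} (hP : IsSmoothPolytope P)
    (hpos : CanonicallyPositioned P)
    (hEdge : ∀ a b : Fin n → ℤ, IsEdge P a b → latticeLength (b - a) = 1)
    (hpts : ∀ i j : Fin n, i ≠ j →
      toR (Pi.single i (1 : ℤ) + Pi.single j (1 : ℤ)) ∈ P)
    (i : Fin n)
    (hi : ∀ j : Fin n, toR (2 • Pi.single i (1 : ℤ) + Pi.single j (1 : ℤ)) ∉ P)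
    {x : Fin n → ℝ} (hx : x ∈ P) : x i ≤ 1 := by
  have hconv : Convex ℝ P := by
    obtain ⟨S, rfl⟩ := hP.1
    exact convex_convexHull ℝ _
  have hedge := hpos.isEdge_single hEdge
  have hv : IsVertex P (toR (Pi.single i 1)) := (hedge i).symm.isVertex_left
  obtain ⟨u, hue, hu, hdet, hcone⟩ := (hP.2.2 _ hv).exists_basis hP.1 hEdge hv
  obtain ⟨k₀, hk₀⟩ := hu 0 (hedge i).symm
  rw [zero_sub] at hk₀
  have huP : ∀ k, toR (Pi.single i 1 + u k) ∈ P := fun k => (hue k).symm.left_mem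
  have hunonneg : ∀ k m, m ≠ i → 0 ≤ u k m := by
    intro k m hm
    have := nonneg_of_mem hP hpos hEdge (huP k) m
    simpa [toR, Pi.single_eq_of_ne hm] using this
  have hrow : ∀ j, ∃ k, u k j ≠ 0 ∧ u k i ≤ 0 ∧ ∀ m, m ≠ i → m ≠ j → u k m = 0 := by
    intro j
    by_cases hji : j = i
    · subst hji
      exact ⟨k₀, by simp [hk₀], by simp [hk₀], fun m hm _ => by
        simp [hk₀, Pi.single_eq_of_ne hm]⟩
    obtain ⟨c, hc, hxc⟩ := hcone _ (hpts i j (Ne.symm hji))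
    have hj : ∑ k, c k * (u k j : ℝ) = 1 := by
      have := hxc j
      simpa [toR, Pi.single_eq_of_ne hji] using this.symm
    obtain ⟨k, -, hk⟩ := Finset.exists_ne_zero_of_sum_ne_zero (hj.trans_ne one_ne_zero)
    obtain ⟨hck, hukj⟩ := mul_ne_zero_iff.1 hk
    have hsupp : ∀ m, m ≠ i → m ≠ j → u k m = 0 := by
      intro m hmi hmj
      have hm : ∑ k, c k * (u k m : ℝ) = 0 := by
        have := hxc m
        simpa [toR, Pi.single_eq_of_ne hmi, Pi.single_eq_of_ne hmj] using this.symm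
      have := (Finset.sum_eq_zero_iff_of_nonneg fun k _ => mul_nonneg (hc k)
        (by exact_mod_cast hunonneg k m hmi)).1 hm k (Finset.mem_univ k)
      exact_mod_cast (mul_eq_zero.1 this).resolve_left hck
    have hone : u k j = 1 := by
      have h1 := hunonneg k j hji
      rcases Int.isUnit_iff.1 (isUnit_of_row_support hdet hji hk₀
        (by exact_mod_cast hukj) hsupp) with h | h <;> omega
    refine ⟨k, by simp [hone], ?_, hsupp⟩
    by_contra! hpos'
    refine hi j ?_
    have hθ : (1 : ℝ) ≤ u k i := by exact_mod_cast hpos'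
    have hle : (2 : ℝ) / (1 + u k i) ≤ 1 := (div_le_one (by linarith)).2 (by linarith)
    convert hconv (hedge j).symm.left_mem (huP k) (sub_nonneg.2 hle)
      (by positivity : (0 : ℝ) ≤ 2 / (1 + u k i)) (by ring) using 1
    funext m
    by_cases hmi : m = i
    · subst hmi
      simp [toR, Pi.single_eq_of_ne (Ne.symm hji)]
      field_simp
    · by_cases hmj : m = j
      · subst hmj
        simp [toR, Pi.single_eq_of_ne hmi, hone]
      · simp [toR, Pi.single_eq_of_ne hmi, Pi.single_eq_of_ne hmj, hsupp m hmi hmj]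
  choose κ hκ0 hκi hκs using hrow
  have hinj : Function.Injective κ := by
    intro j j' h
    by_contra hne
    by_cases hj : j = i
    · exact hκ0 j' (h ▸ hκs j j' (fun e => hne (hj.trans e.symm)) (Ne.symm hne))
    · exact hκ0 j (h ▸ hκs j' j hj hne)
  obtain ⟨c, hc, hxc⟩ := hcone x hx
  rw [hxc i]
  have : ∑ k, c k * (u k i : ℝ) ≤ 0 := by
    refine Finset.sum_nonpos fun k _ => mul_nonpos_of_nonneg_of_nonpos (hc k) ?_
    obtain ⟨j, rfl⟩ := Finite.surjective_of_injective hinj k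
    exact_mod_cast hκi j
  simpa using this

/-- Let `P ⊂ ℝⁿ` be a full-dimensional smooth lattice polytope,
canonically positioned, with every edge of lattice length exactly `1`, and with
`eᵢ + eⱼ ∈ P` for all `i ≠ j`. If for some `i` the point `2eᵢ + eⱼ` is not in `P` for
every `j`, then `P ⊆ {x : 0 ≤ xᵢ ≤ 1}`, and `P` is a Cayley polytope of order `1`
with altitude in direction `eᵢ`. -/
theorem stmt_10 {n : ℕ} (P : Set (Fin n → ℝ)) (hP : IsSmoothPolytope P)
    (hpos : CanonicallyPositioned P)
    (hEdge : ∀ a b : Fin n → ℤ, IsEdge P a b → latticeLength (b - a) = 1)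
    (hpts : ∀ i j : Fin n, i ≠ j →
      toR (Pi.single i (1 : ℤ) + Pi.single j (1 : ℤ)) ∈ P)
    (i : Fin n)
    (hi : ∀ j : Fin n, toR (2 • Pi.single i (1 : ℤ) + Pi.single j (1 : ℤ)) ∉ P) :
    (∀ x ∈ P, 0 ≤ x i ∧ x i ≤ (1 : ℝ)) ∧ IsCayley P 1 i := by
  have hbound : ∀ x ∈ P, 0 ≤ x i ∧ x i ≤ (1 : ℝ) := fun x hx =>
    ⟨nonneg_of_mem hP hpos hEdge hx i, coord_le_one hP hpos hEdge hpts i hi hx⟩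
  refine ⟨hbound, by simpa using hbound, fun v hv => ?_⟩
  obtain ⟨S, hS⟩ := hP.1
  have hvP := hbound v hv.1
  rw [IsVertex, hS] at hv
  obtain ⟨s, -, rfl⟩ := extremePoints_convexHull_subset hv
  have h0 : 0 ≤ s i := Int.cast_nonneg_iff.1 hvP.1
  have h1 : s i ≤ 1 := Int.cast_le.1 (hvP.2.trans_eq Int.cast_one.symm)
  rcases (by omega : s i = 0 ∨ s i = 1) with h | h <;> simp [toR, h]
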